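/- arXiv:math/0608130 — 2 statements merged into one kernel-verified Lean document; each statement's English description precedes it below -/
import Mathlib

section
/- For an invertible n×n scalar matrix T = (t_{ij}) with inverse S = (s_{ij}): min rank of the lower-triangular partial matrix {t_{ij} : i ≥ j} plus min rank of the strictly-lower-triangular partial matrix {s_{ij} : i > j} equals n. -/
open Matrix in
theorem mr_strict_mul {F : Type*} [Field F] {n : ℕ} (A B : Matrix (Fin n) (Fin n) F)
    (hA : ∀ i j : Fin n, j ≤ i → A i j = 0) (hB : ∀ i j : Fin n, j < i → B i j = 0) :
    ∀ i j : Fin n, j ≤ i → (A * B) i j = 0 := by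
  intro i j hij
  rw [Matrix.mul_apply]
  refine Finset.sum_eq_zero fun k _ => ?_
  rcases le_or_gt k i with h | h
  · rw [hA i k h, zero_mul]
  · rw [hB k j (lt_of_le_of_lt hij h), mul_zero]

theorem mr_mul_strict {F : Type*} [Field F] {n : ℕ} (A B : Matrix (Fin n) (Fin n) F)
    (hA : ∀ i j : Fin n, j < i → A i j = 0) (hB : ∀ i j : Fin n, j ≤ i → B i j = 0) :
    ∀ i j : Fin n, j ≤ i → (A * B) i j = 0 := by
  intro i j hij
  rw [Matrix.mul_apply]
  refine Finset.sum_eq_zero fun k _ => ?_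
  rcases lt_or_ge k i with h | h
  · rw [hA i k h, zero_mul]
  · rw [hB k j (le_trans hij h), mul_zero]

theorem mr_mul_upper {F : Type*} [Field F] {n : ℕ} (A B : Matrix (Fin n) (Fin n) F)
    (hA : ∀ i j : Fin n, j < i → A i j = 0) (hB : ∀ i j : Fin n, j < i → B i j = 0) :
    ∀ i j : Fin n, j < i → (A * B) i j = 0 := by
  intro i j hij
  rw [Matrix.mul_apply]
  refine Finset.sum_eq_zero fun k _ => ?_
  rcases lt_or_ge k i with h | h
  · rw [hA i k h, zero_mul]
  · rw [hB k j (lt_of_lt_of_le hij h), mul_zero]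

/-- An upper triangular matrix with nonzero diagonal has an upper triangular inverse. -/
theorem mr_inv {F : Type*} [Field F] {n : ℕ} (A : Matrix (Fin n) (Fin n) F)
    (hA : ∀ i j : Fin n, j < i → A i j = 0) (hd : ∀ i, A i i ≠ 0) :
    ∃ B : Matrix (Fin n) (Fin n) F, A * B = 1 ∧ B * A = 1 ∧
      ∀ i j : Fin n, j < i → B i j = 0 := by
  have ht : A.BlockTriangular id := fun i j h => hA i j h
  have hdet : IsUnit A.det := by
    rw [Matrix.det_of_upperTriangular ht, isUnit_iff_ne_zero]
    exact Finset.prod_ne_zero_iff.mpr fun i _ => hd i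
  haveI := A.invertibleOfIsUnitDet hdet
  refine ⟨A⁻¹, Matrix.mul_nonsing_inv A hdet, Matrix.nonsing_inv_mul A hdet, ?_⟩
  intro i j h
  exact Matrix.blockTriangular_inv_of_blockTriangular ht h

theorem mr_level {F : Type*} [Field F] {n : ℕ} (x : Fin n → F) (hx : x ≠ 0) :
    ∃ k, x k ≠ 0 ∧ ∀ l, k < l → x l = 0 := by
  classical
  obtain ⟨k0, hk0⟩ := Function.ne_iff.mp hx
  have hne : (Finset.univ.filter fun k => x k ≠ 0).Nonempty := ⟨k0, by simpa using hk0⟩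
  refine ⟨_, (Finset.mem_filter.mp (Finset.max'_mem _ hne)).2, fun l hl => ?_⟩
  by_contra h
  exact absurd (Finset.le_max' _ l (by simpa using h)) (not_le.mpr hl)

open Matrix in
theorem mr_lower {F : Type*} [Field F] {n : ℕ}
    (T S B C : Matrix (Fin n) (Fin n) F) (h2 : S * T = 1)
    (hB : ∀ i j : Fin n, j ≤ i → B i j = T i j)
    (hC : ∀ i j : Fin n, j < i → C i j = S i j) : n ≤ B.rank + C.rank := by
  have hM := mr_mul_strict (C - S) (B - T) (fun i j h => by simp [hC i j h])
    (fun i j h => by simp [hB i j h])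
  set M := (C - S) * (B - T) with hMdef
  have hdet : (1 - M).det ≠ 0 := by
    have ht : (1 - M).BlockTriangular id := by
      intro i j h
      have h' : j < i := h
      simp [hM i j h'.le, Matrix.one_apply_ne h'.ne']
    rw [Matrix.det_of_upperTriangular ht]
    simp [hM]
  have hdisj : Disjoint (LinearMap.ker B.mulVecLin) (LinearMap.ker (C * T).mulVecLin) := by
    rw [Submodule.disjoint_def]
    intro x hx hy
    simp only [LinearMap.mem_ker, Matrix.mulVecLin_apply] at hx hy
    apply Matrix.eq_zero_of_mulVec_eq_zero hdet
    have e : (1 - M) = C * T - (C - S) * B := by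
      rw [hMdef, ← h2]; noncomm_ring
    rw [e, Matrix.sub_mulVec, hy, ← Matrix.mulVec_mulVec, hx]
    simp
  have hd := Submodule.finrank_add_finrank_le_of_disjoint hdisj
  have a := LinearMap.finrank_range_add_finrank_ker B.mulVecLin
  have b := LinearMap.finrank_range_add_finrank_ker (C * T).mulVecLin
  have c := Matrix.rank_mul_le_left C T
  simp only [Module.finrank_fin_fun] at hd a b
  change B.rank + _ = n at a
  change (C * T).rank + _ = n at b
  omega

open Matrix in
theorem mr_bruhat {F : Type*} [Field F] {n : ℕ}
    (T S : Matrix (Fin n) (Fin n) F) (h2 : S * T = 1) :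
    ∃ (U : Matrix (Fin n) (Fin n) F) (σ : Equiv.Perm (Fin n)),
      (∀ i j : Fin n, j < i → U i j = 0) ∧ (∀ i, U i i ≠ 0) ∧
      (∀ i, (T * U) (σ i) i ≠ 0) ∧ (∀ i l, σ i < l → (T * U) l i = 0) := by
  classical
  have key : ∀ i : Fin n, ∃ (x : Fin n → F) (q : Fin n), (x i ≠ 0 ∧ (∀ l, i < l → x l = 0)) ∧
      ((T *ᵥ x) q ≠ 0 ∧ (∀ l, q < l → (T *ᵥ x) l = 0)) ∧
      ∀ y : Fin n → F, y i ≠ 0 → (∀ l, i < l → y l = 0) → ∃ l, q ≤ l ∧ (T *ᵥ y) l ≠ 0 := by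
    intro i
    have inj : ∀ x : Fin n → F, x ≠ 0 → T *ᵥ x ≠ 0 := by
      intro x hx h
      apply hx
      have : (S * T) *ᵥ x = 0 := by rw [← Matrix.mulVec_mulVec, h, Matrix.mulVec_zero]
      simpa [h2] using this
    let Q : Set (Fin n) := {q | ∃ x : Fin n → F, (x i ≠ 0 ∧ (∀ l, i < l → x l = 0)) ∧
      ((T *ᵥ x) q ≠ 0 ∧ (∀ l, q < l → (T *ᵥ x) l = 0))}
    have hQ : Q.Nonempty := by
      have h0 : (Pi.single i 1 : Fin n → F) ≠ 0 := by simp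
      obtain ⟨k, hk⟩ := mr_level _ (inj _ h0)
      exact ⟨k, Pi.single i 1, ⟨by simp, fun l hl => by simp [hl.ne']⟩, hk⟩
    obtain ⟨q, ⟨x, hx, hTx⟩, hmin⟩ :=
      WellFounded.has_min (wellFounded_lt : WellFounded ((· < ·) : Fin n → Fin n → Prop)) Q hQ
    refine ⟨x, q, hx, hTx, fun y hy hy' => ?_⟩
    have hy0 : y ≠ 0 := fun h => hy (by simp [h])
    obtain ⟨k, hk⟩ := mr_level _ (inj _ hy0)
    exact ⟨k, not_lt.mp (hmin k ⟨y, ⟨hy, hy'⟩, hk⟩), hk.1⟩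
  choose x q hx hTx hmin using key
  have aux : ∀ i j, i < j → q i ≠ q j := by
    intro i j hij hq
    obtain ⟨l, hl, hne⟩ := hmin j (x j - ((T *ᵥ x j) (q j) / (T *ᵥ x i) (q i)) • x i)
      (by simp [(hx i).2 j hij, (hx j).1])
      (fun l hl => by simp [(hx i).2 l (hij.trans hl), (hx j).2 l hl])
    apply hne
    rw [Matrix.mulVec_sub, Matrix.mulVec_smul]
    rcases hl.eq_or_lt with h | h
    · have := (hTx i).1
      subst h
      rw [hq] at this
      simp [hq, this]
    · simp [(hTx j).2 l h, (hTx i).2 l (hq ▸ h)]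
  have hinj : Function.Injective q := by
    intro i j h
    rcases lt_trichotomy i j with h' | h' | h'
    · exact absurd h (aux i j h')
    · exact h'
    · exact absurd h.symm (aux j i h')
  have e : ∀ l i, (T * Matrix.of fun a b => x b a) l i = (T *ᵥ x i) l := fun l i => rfl
  refine ⟨Matrix.of fun a b => x b a,
    Equiv.ofBijective q (Finite.injective_iff_bijective.mp hinj),
    fun i j h => (hx j).2 i h, fun i => (hx i).1, fun i => ?_, fun i l h => ?_⟩
  · rw [e]; exact (hTx i).1
  · rw [e]; exact (hTx i).2 l h

theorem mr_upper {F : Type*} [Field F] {n : ℕ}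
    (T S : Matrix (Fin n) (Fin n) F) (h2 : S * T = 1) :
    ∃ B C : Matrix (Fin n) (Fin n) F,
      (∀ i j : Fin n, j ≤ i → B i j = T i j) ∧
      (∀ i j : Fin n, j < i → C i j = S i j) ∧ B.rank + C.rank ≤ n := by
  classical
  obtain ⟨U, σ, hU, hUd, hσ, hσ'⟩ := mr_bruhat T S h2
  obtain ⟨V, hUV, hVU, hV⟩ := mr_inv U hU hUd
  obtain ⟨W, hYW, hWY, hW⟩ := mr_inv ((T * U).submatrix id σ.symm)
    (fun i j h => hσ' (σ.symm j) i (by simpa using h))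
    (fun i => by simpa using hσ (σ.symm i))
  let d : Fin n → F := fun i => if i ≤ σ i then 1 else 0
  let d' : Fin n → F := fun i => if i ≤ σ i then 0 else 1
  have hdd : Matrix.diagonal d + Matrix.diagonal d' = 1 := by
    rw [Matrix.diagonal_add, ← Matrix.diagonal_one]
    congr 1; funext i; simp only [d, d']; split_ifs <;> simp
  refine ⟨T * U * Matrix.diagonal d * V, U * Matrix.diagonal d' * V * S, ?_, ?_, ?_⟩
  · have e : T * U * Matrix.diagonal d * V - T = -(T * U * Matrix.diagonal d') * V := by
      have : T = T * U * (Matrix.diagonal d + Matrix.diagonal d') * V := by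
        rw [hdd, mul_one, mul_assoc, hUV, mul_one]
      nth_rewrite 2 [this]
      noncomm_ring
    intro i j h
    rw [← sub_eq_zero, ← Matrix.sub_apply, e]
    refine mr_strict_mul _ V ?_ hV i j h
    intro i j h
    rw [Matrix.neg_apply, Matrix.mul_diagonal]
    simp only [d']
    split_ifs with hs
    · simp
    · rw [hσ' j i (lt_of_lt_of_le (not_le.mp hs) h)]; simp
  · have e : U * Matrix.diagonal d' * V * S - S
        = -((U * Matrix.diagonal d).submatrix id σ.symm) * W := by
      have e1 : (U * Matrix.diagonal d' * V * S - S) * (T * U) = -(U * Matrix.diagonal d) := by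
        have : (U * Matrix.diagonal d' * V * S - S) * (T * U)
          = U * Matrix.diagonal d' * (V * ((S * T) * U)) - (S * T) * U := by noncomm_ring
        rw [this, h2, one_mul, hVU, mul_one, sub_eq_iff_eq_add, ← sub_eq_iff_eq_add', sub_neg_eq_add,
          add_comm, ← mul_add, hdd, mul_one]
      have e2 : (U * Matrix.diagonal d' * V * S - S) * ((T * U).submatrix id σ.symm)
          = -((U * Matrix.diagonal d).submatrix id σ.symm) := by
        ext i j
        exact congrFun (congrFun e1 i) (σ.symm j)
      rw [← e2, mul_assoc _ _ W, hYW, mul_one]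
    intro i j h
    rw [← sub_eq_zero, ← Matrix.sub_apply, e]
    refine mr_mul_upper _ W ?_ hW i j h
    intro i j h
    rw [Matrix.neg_apply, Matrix.submatrix_apply, Matrix.mul_diagonal]
    simp only [d]
    split_ifs with hs
    · rw [Equiv.apply_symm_apply] at hs
      rw [id, hU i _ (lt_of_le_of_lt hs h)]; simp
    · simp
  · have r1 : (T * U * Matrix.diagonal d * V).rank ≤ (Matrix.diagonal d).rank :=
      (Matrix.rank_mul_le_left _ _).trans (Matrix.rank_mul_le_right _ _)
    have r2 : (U * Matrix.diagonal d' * V * S).rank ≤ (Matrix.diagonal d').rank :=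
      (Matrix.rank_mul_le_left _ _).trans
        ((Matrix.rank_mul_le_left _ _).trans (Matrix.rank_mul_le_right _ _))
    have r3 : (Matrix.diagonal d).rank + (Matrix.diagonal d').rank = n := by
      rw [Matrix.rank_diagonal, Matrix.rank_diagonal, Fintype.card_subtype, Fintype.card_subtype]
      have := Finset.card_filter_add_card_filter_not (s := (Finset.univ : Finset (Fin n)))
        (fun i => i ≤ σ i)
      simpa [d, d'] using this
    omega


/-- Scalar case of the main theorem: for an invertible `n×n` matrix `T`
with inverse `S`, the minimal rank of the lower-triangular part of `T`
plus the minimal rank of the strictly-lower-triangular part of `S`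
equals `n`. -/
theorem minRank_matrix_and_inverse {F : Type*} [Field F] {n : ℕ}
    (T S : Matrix (Fin n) (Fin n) F) (h1 : T * S = 1) (h2 : S * T = 1) :
    sInf {r : ℕ | ∃ B : Matrix (Fin n) (Fin n) F,
        (∀ i j : Fin n, j ≤ i → B i j = T i j) ∧ B.rank = r}
      + sInf {r : ℕ | ∃ B : Matrix (Fin n) (Fin n) F,
        (∀ i j : Fin n, j < i → B i j = S i j) ∧ B.rank = r} = n := by

  obtain ⟨B, C, hB, hC, hr⟩ := mr_upper T S h2
  apply le_antisymm
  · refine le_trans (add_le_add (Nat.sInf_le (m := B.rank) ?_) (Nat.sInf_le (m := C.rank) ?_)) hr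
    · exact ⟨B, hB, rfl⟩
    · exact ⟨C, hC, rfl⟩
  · obtain ⟨B', hB', e1⟩ := Nat.sInf_mem (s := {r : ℕ | ∃ B : Matrix (Fin n) (Fin n) F,
        (∀ i j : Fin n, j ≤ i → B i j = T i j) ∧ B.rank = r}) ⟨_, B, hB, rfl⟩
    obtain ⟨C', hC', e2⟩ := Nat.sInf_mem (s := {r : ℕ | ∃ B : Matrix (Fin n) (Fin n) F,
        (∀ i j : Fin n, j < i → B i j = S i j) ∧ B.rank = r}) ⟨_, C, hC, rfl⟩
    rw [← e1, ← e2]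
    exact mr_lower T S B' C' h2 hB' hC'
end

section
/- Let T = {T_{ij} : 1 ≤ j ≤ i ≤ n} be a lower-triangular partial block matrix over a field. Then its minimal rank equals Σ_{i=1}^{n} rank[(T_{kl})_{k=i..n, l=1..i}] − Σ_{i=1}^{n-1} rank[(T_{kl})_{k=i+1..n, l=1..i}]. -/
section MinRankAux
open Module Submodule

theorem mr_section {F M N : Type*} [Field F] [AddCommGroup M] [Module F M] [AddCommGroup N]
    [Module F N] [FiniteDimensional F M] [FiniteDimensional F N] (π : M →ₗ[F] N)
    (hπ : Function.Surjective π) (V : Submodule F M) :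
    ∃ s : N →ₗ[F] M, (∀ y, π (s y) = y) ∧ ∀ Z : Submodule F N,
      finrank F ↥(V ⊔ Z.map s) + finrank F (V.map π)
        ≤ finrank F V + finrank F ↥(V.map π ⊔ Z) := by
  obtain ⟨s₀, hs₀⟩ := π.exists_rightInverse_of_surjective (LinearMap.range_eq_top.2 hπ)
  have hs₀' : ∀ y, π (s₀ y) = y := fun y => LinearMap.congr_fun hs₀ y
  obtain ⟨t, ht⟩ := (π.submoduleMap V).exists_rightInverse_of_surjective
    (LinearMap.range_eq_top.2 (π.submoduleMap_surjective V))
  obtain ⟨g, hg⟩ := LinearMap.exists_extend (V.subtype ∘ₗ t)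
  have hgt : ∀ y : V.map π, g y = (t y : M) := fun y => LinearMap.congr_fun hg y
  have hpt : ∀ y : V.map π, π (t y : M) = y := fun y => by
    have := congrArg Subtype.val (LinearMap.congr_fun ht y)
    simpa using this
  let s : N →ₗ[F] M := g - s₀ ∘ₗ (π ∘ₗ g - LinearMap.id)
  have hs : ∀ y, π (s y) = y := fun y => by simp [s, hs₀']
  have hsV : (V.map π).map s ≤ V := by
    rintro _ ⟨y, hy, rfl⟩
    have : s y = (t ⟨y, hy⟩ : M) := by
      have h1 := hgt ⟨y, hy⟩
      have h2 := hpt ⟨y, hy⟩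
      simp only at h1 h2
      simp [s, h1, h2]
    rw [this]; exact (t ⟨y, hy⟩).2
  have hinj : Function.Injective s := Function.LeftInverse.injective hs
  refine ⟨s, hs, fun Z => ?_⟩
  have e1 : V ⊔ Z.map s = V ⊔ (V.map π ⊔ Z).map s := by
    rw [Submodule.map_sup, ← sup_assoc, sup_eq_left.2 hsV]
  have e2 := Submodule.finrank_sup_add_finrank_inf_eq V ((V.map π ⊔ Z).map s)
  have e3 : finrank F ↥((V.map π).map s) ≤ finrank F ↥(V ⊓ (V.map π ⊔ Z).map s) :=
    Submodule.finrank_mono (le_inf hsV (Submodule.map_mono le_sup_left))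
  rw [← (Submodule.equivMapOfInjective s hinj _).finrank_eq] at e3
  rw [← (Submodule.equivMapOfInjective s hinj (V.map π ⊔ Z)).finrank_eq] at e2
  rw [e1]; omega

theorem mr_lower_s19 {F M N : Type*} [Field F] [AddCommGroup M] [Module F M] [AddCommGroup N]
    [Module F N] [FiniteDimensional F M] (π : M →ₗ[F] N)
    {V W : Submodule F M} (h : V ≤ W) :
    finrank F V + finrank F (W.map π) ≤ finrank F W + finrank F (V.map π) := by
  have key : ∀ U : Submodule F M,
      finrank F (U.map π) + finrank F ↥(U ⊓ LinearMap.ker π) = finrank F U := by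
    intro U
    have := LinearMap.finrank_range_add_finrank_ker (π.domRestrict U)
    rw [LinearMap.range_domRestrict] at this
    rw [← this, LinearMap.ker_domRestrict, ← Submodule.map_comap_subtype,
      Submodule.finrank_map_subtype_eq]
  have h1 := key V
  have h2 := key W
  have h3 : finrank F ↥(V ⊓ LinearMap.ker π) ≤ finrank F ↥(W ⊓ LinearMap.ker π) :=
    Submodule.finrank_mono (inf_le_inf_right _ h)
  omega

variable {F R C : Type*} [Field F] [Fintype R] [Fintype C]

/-- Span of the columns of level `< j`. -/
def mrV (b : C → ℕ) (x : C → R → F) (j : ℕ) : Submodule F (R → F) :=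
  span F (x '' {q | b q < j})

theorem mrV_zero (b : C → ℕ) (x : C → R → F) : mrV b x 0 = ⊥ := by
  have : {q | b q < 0} = ∅ := by ext q; simp
  rw [mrV, this, Set.image_empty, span_empty]

/-- Restriction to the rows of level `≥ i`. -/
def mrPi (F : Type*) [Field F] (a : R → ℕ) (i : ℕ) : (R → F) →ₗ[F] ({p // i ≤ a p} → F) :=
  LinearMap.funLeft F F Subtype.val

theorem mrV_congr (a : R → ℕ) (b : C → ℕ) {x y : C → R → F} {i j : ℕ}
    (h : ∀ q, b q < j → ∀ p, i ≤ a p → x q p = y q p) :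
    (mrV b x j).map (mrPi F a i) = (mrV b y j).map (mrPi F a i) := by
  unfold mrV
  rw [Submodule.map_span, Submodule.map_span, Set.image_image, Set.image_image]
  congr 1
  refine Set.image_congr fun q hq => ?_
  ext p
  exact h q hq p.1 p.2

/-- Rank of the block with rows of level `≥ i` and columns of level `< j`. -/
noncomputable def mrE (a : R → ℕ) (b : C → ℕ) (x : C → R → F) (i j : ℕ) : ℕ :=
  finrank F ((mrV b x j).map (mrPi F a i))

theorem mr_lower_sum (a : R → ℕ) (b : C → ℕ) (T x : C → R → F)
    (h : ∀ q p, b q ≤ a p → x q p = T q p) (m : ℕ) :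
    ∑ i ∈ Finset.range m, mrE a b T i (i + 1)
      ≤ finrank F (mrV b x m) + ∑ i ∈ Finset.range m, mrE a b T i i := by
  induction m with
  | zero => simp
  | succ m ih =>
    rw [Finset.sum_range_succ, Finset.sum_range_succ]
    have hle : mrV b x m ≤ mrV b x (m + 1) :=
      span_mono (Set.image_mono fun q (hq : b q < m) => Nat.lt_succ_of_lt hq)
    have h1 := mr_lower_s19 (mrPi F a m) hle
    rw [mrV_congr a b (y := T) (fun q hq p hp => h q p (by omega)),
      mrV_congr a b (y := T) (fun q hq p hp => h q p (by omega))] at h1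
    unfold mrE at *
    omega

theorem mr_upper_sum (a : R → ℕ) (b : C → ℕ) (T : C → R → F) (m : ℕ) :
    ∃ x : C → R → F, (∀ q p, b q < m → b q ≤ a p → x q p = T q p) ∧
      finrank F (mrV b x m) + ∑ i ∈ Finset.range m, mrE a b T i i
        ≤ ∑ i ∈ Finset.range m, mrE a b T i (i + 1) := by
  induction m with
  | zero => exact ⟨T, fun q p h => by omega, by simp [mrV_zero]⟩
  | succ m ih =>
    obtain ⟨x, hx, ih⟩ := ih
    obtain ⟨s, hs, hZ⟩ := mr_section (mrPi F a m)
      (LinearMap.funLeft_surjective_of_injective F F _ Subtype.val_injective) (mrV b x m)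
    classical
    have hset : {q | b q < m + 1} = {q | b q < m} ∪ {q | b q = m} := by
      ext q; simp; omega
    refine ⟨fun q => if b q = m then s (mrPi F a m (T q)) else x q, ?_, ?_⟩
    · intro q p hq hqp
      by_cases hb : b q = m
      · simp only [hb, if_true]
        have := congrFun (hs (mrPi F a m (T q))) ⟨p, hb ▸ hqp⟩
        exact this
      · simp only [hb, if_false]
        exact hx q p (by omega) hqp
    · have e1 : mrV b (fun q => if b q = m then s (mrPi F a m (T q)) else x q) (m + 1)
          = mrV b x m ⊔ (span F ((fun q => mrPi F a m (T q)) '' {q | b q = m})).map s := by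
        unfold mrV
        rw [hset, Set.image_union, span_union, Submodule.map_span, Set.image_image]
        congr 2
        · refine Set.image_congr fun q (hq : b q < m) => ?_
          simp [hq.ne]
        · refine Set.image_congr fun q (hq : b q = m) => ?_
          simp [hq]
      have e2 : (mrV b T (m + 1)).map (mrPi F a m) = (mrV b x m).map (mrPi F a m) ⊔
          span F ((fun q => mrPi F a m (T q)) '' {q | b q = m}) := by
        rw [mrV_congr a b (y := T) (fun q hq p hp => hx q p hq (by omega))]
        unfold mrV
        rw [hset, Set.image_union, span_union, Submodule.map_sup]
        congr 1
        rw [Submodule.map_span, Set.image_image]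
      have h1 := hZ (span F ((fun q => mrPi F a m (T q)) '' {q | b q = m}))
      rw [← e1, ← e2, mrV_congr a b (y := T) (fun q hq p hp => hx q p hq (by omega))] at h1
      rw [Finset.sum_range_succ, Finset.sum_range_succ]
      unfold mrE at *
      omega

theorem mrE_rank (a : R → ℕ) (b : C → ℕ) (T : Matrix R C F) (i j : ℕ) (P : R → Prop) (Q : C → Prop)
    (hP : ∀ p, P p ↔ i ≤ a p) (hQ : ∀ q, Q q ↔ b q < j) [Fintype {q // Q q}] :
    (Matrix.of fun (p : {p // P p}) (q : {q // Q q}) => T p.1 q.1).rank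
      = mrE a b (fun q p => T p q) i j := by
  obtain rfl : P = fun p => i ≤ a p := funext fun p => propext (hP p)
  obtain rfl : Q = fun q => b q < j := funext fun p => propext (hQ p)
  rw [Matrix.rank_eq_finrank_span_cols]
  unfold mrE mrV
  rw [Submodule.map_span, Set.image_image, Set.image_eq_range]
  rfl

theorem mr_rank_full (b : C → ℕ) (B : Matrix R C F) (j : ℕ) (hb : ∀ q, b q < j) :
    B.rank = finrank F (mrV b (fun q p => B p q) j) := by
  rw [Matrix.rank_eq_finrank_span_cols]
  unfold mrV
  have : {q | b q < j} = Set.univ := by ext q; simp [hb]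
  rw [this, Set.image_univ]
  rfl

end MinRankAux


/-- General minimal rank formula for a lower-triangular partial block
matrix (Theorem 2): blocks `T_{ij}` of size `ν i × μ j` are specified for
`j ≤ i`; the minimal rank over all completions equals
`Σ_{i=1}^{n} rank (T_{kl})_{k≥i, l≤i} − Σ_{i=1}^{n-1} rank (T_{kl})_{k>i, l≤i}`.
(The second sum is taken over all `i : Fin n`; the term for the last index
is the rank of an empty matrix, which is zero.) -/
theorem minRank_lower_triangular_block {F : Type*} [Field F] {n : ℕ}
    (ν μ : Fin n → ℕ)
    (T : Matrix ((i : Fin n) × Fin (ν i)) ((j : Fin n) × Fin (μ j)) F) :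
    sInf {r : ℕ | ∃ B : Matrix ((i : Fin n) × Fin (ν i)) ((j : Fin n) × Fin (μ j)) F,
        (∀ p q, q.1 ≤ p.1 → B p q = T p q) ∧ B.rank = r} =
      (∑ i : Fin n,
        (Matrix.of fun (p : {p : (i' : Fin n) × Fin (ν i') // i ≤ p.1})
            (q : {q : (j : Fin n) × Fin (μ j) // q.1 ≤ i}) => T p.1 q.1).rank)
      - (∑ i : Fin n,
        (Matrix.of fun (p : {p : (i' : Fin n) × Fin (ν i') // i < p.1})
            (q : {q : (j : Fin n) × Fin (μ j) // q.1 ≤ i}) => T p.1 q.1).rank) := by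

  let a : ((i : Fin n) × Fin (ν i)) → ℕ := fun p => p.1
  let b : ((j : Fin n) × Fin (μ j)) → ℕ := fun q => q.1
  let E := mrE a b (fun q p => T p q)
  have hS : ∀ i : Fin n, (Matrix.of fun (p : {p : (i' : Fin n) × Fin (ν i') // i ≤ p.1})
      (q : {q : (j : Fin n) × Fin (μ j) // q.1 ≤ i}) => T p.1 q.1).rank = E i (i + 1) :=
    fun i => mrE_rank a b T _ _ _ _ (fun p => Fin.le_def)
      (fun q => by rw [Fin.le_def]; exact Nat.lt_succ_iff.symm)
  have hD : ∀ i : Fin n, (Matrix.of fun (p : {p : (i' : Fin n) × Fin (ν i') // i < p.1})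
      (q : {q : (j : Fin n) × Fin (μ j) // q.1 ≤ i}) => T p.1 q.1).rank = E (i + 1) (i + 1) :=
    fun i => mrE_rank a b T _ _ _ _ (fun p => Fin.lt_def)
      (fun q => by rw [Fin.le_def]; exact Nat.lt_succ_iff.symm)
  simp only [hS, hD]
  rw [Fin.sum_univ_eq_sum_range (fun i => E i (i + 1)),
    Fin.sum_univ_eq_sum_range (fun i => E (i + 1) (i + 1))]
  have hE0 : E 0 0 = 0 := by simp [E, mrE, mrV_zero]
  have hEn : E n n = 0 := by
    have : IsEmpty {p // n ≤ a p} := ⟨fun p => absurd p.1.1.2 (not_lt.2 p.2)⟩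
    exact Module.finrank_zero_of_subsingleton
  have hsum : ∑ i ∈ Finset.range n, E (i + 1) (i + 1) = ∑ i ∈ Finset.range n, E i i := by
    have h1 := Finset.sum_range_succ (fun i => E i i) n
    have h2 := Finset.sum_range_succ' (fun i => E i i) n
    omega
  rw [hsum]
  have hlow : ∀ B : Matrix ((i : Fin n) × Fin (ν i)) ((j : Fin n) × Fin (μ j)) F,
      (∀ p q, q.1 ≤ p.1 → B p q = T p q) →
      ∑ i ∈ Finset.range n, E i (i + 1) ≤ B.rank + ∑ i ∈ Finset.range n, E i i := by
    intro B hB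
    rw [mr_rank_full b B n (fun q => q.1.2)]
    exact mr_lower_sum a b _ _ (fun q p h => hB p q h) n
  obtain ⟨x, hx, hle⟩ := mr_upper_sum a b (fun q p => T p q) n
  have hxB : ∀ p q, q.1 ≤ p.1 → (Matrix.of fun p q => x q p) p q = T p q :=
    fun p q h => hx q p q.1.2 h
  have hxr := mr_rank_full b (Matrix.of fun p q => x q p) n (fun q => q.1.2)
  have hge := hlow _ hxB
  apply le_antisymm
  · refine le_trans (Nat.sInf_le (m := (Matrix.of fun p q => x q p).rank) ⟨_, hxB, rfl⟩) ?_
    rw [hxr]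
    exact Nat.le_sub_of_add_le hle
  · refine le_csInf ⟨_, _, hxB, rfl⟩ ?_
    rintro r ⟨B, hB, rfl⟩
    have := hlow B hB
    omega
end
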